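/- arXiv:2102.04401 — 3 statements merged into one kernel-verified Lean document; each statement's English description precedes it below -/
import Mathlib

section
/- Let m be a positive integer, ε > 0, d a positive integer, and let f : ℝ^m → {−1, 1} be measurable. Suppose that for every polynomial p : ℝ^m → ℝ of degree at most d−1 it holds that E_{x∼γ_m}[|p(x) − f(x)|] ≥ 2ε. Then there exists a measurable function g : ℝ^m → [−1, 1] such that: (1) E_{x∼γ_m}[P(x) g(x)] = 0 for every polynomial P : ℝ^m → ℝ of degree at most d−1 (i.e., g has zero low-degree moments); and (2) E_{x∼γ_m}[|g(x) − f(x)|] ≤ 1 − 2ε. -/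
open MeasureTheory ProbabilityTheory

/-- The standard `n`-dimensional Gaussian distribution `N(0, I_n)` on `ℝ^n`. -/
noncomputable def gaussian (n : ℕ) : Measure (Fin n → ℝ) :=
  Measure.pi fun _ => gaussianReal 0 1

instance isProbabilityMeasure_gaussian (n : ℕ) : IsProbabilityMeasure (gaussian n) := by
  unfold gaussian; infer_instance

theorem integrable_eval_gaussian {n : ℕ} (p : MvPolynomial (Fin n) ℝ) :
    Integrable (fun x => MvPolynomial.eval x p) (gaussian n) := by
  have hpow (k : ℕ) : Integrable (fun t : ℝ => t ^ k) (gaussianReal 0 1) := by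
    refine (integrable_norm_iff (by fun_prop)).1 ?_
    simpa using (memLp_id_gaussianReal (μ := 0) (v := 1) k).integrable_norm_pow'
  simp_rw [MvPolynomial.eval_eq']
  refine integrable_finsetSum _ fun s _ => Integrable.const_mul ?_ _
  exact Integrable.fintype_prod (f := fun i t => t ^ s i) fun i => hpow (s i)

theorem memLp_two_eval_gaussian {n : ℕ} (p : MvPolynomial (Fin n) ℝ) :
    MemLp (fun x => MvPolynomial.eval x p) 2 (gaussian n) := by
  refine (memLp_two_iff_integrable_sq (integrable_eval_gaussian p).aestronglyMeasurable).2 ?_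
  exact (integrable_eval_gaussian (p ^ 2)).congr (.of_forall fun x => map_pow _ _ _)

section Duality

variable {α : Type*} [MeasurableSpace α] {μ : Measure α}

theorem MeasureTheory.MemLp.norm_toLp_one {h : α → ℝ} (hh : MemLp h 1 μ) :
    ‖hh.toLp h‖ = ∫ x, |h x| ∂μ := by
  rw [L1.norm_eq_integral_norm]
  exact integral_congr_ae (by filter_upwards [hh.coeFn_toLp] with x hx; simp [hx])

/-- A functional of norm at most one on `L¹` of a finite measure is, on square-integrable
functions, integration against a `[-1,1]`-valued measurable function. -/
theorem exists_measurable_bounded_repr [IsFiniteMeasure μ] (φ : StrongDual ℝ (Lp ℝ 1 μ))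
    (hφ : ‖φ‖ ≤ 1) :
    ∃ g : α → ℝ, Measurable g ∧ (∀ x, g x ∈ Set.Icc (-1 : ℝ) 1) ∧
      ∀ h : α → ℝ, MemLp h 2 μ → ∀ h1 : MemLp h 1 μ, φ (h1.toLp h) = ∫ x, h x * g x ∂μ := by
  have h12 {h : α → ℝ} (hh : MemLp h 2 μ) : MemLp h 1 μ := hh.mono_exponent (by norm_num)
  have hL (u : Lp ℝ 2 μ) : MemLp u 1 μ := h12 (Lp.memLp u)
  let ι : Lp ℝ 2 μ →ₗ[ℝ] Lp ℝ 1 μ :=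
    { toFun := fun u => (hL u).toLp u
      map_add' := fun u v => by
        rw [← MemLp.toLp_add]
        exact MemLp.toLp_congr _ _ (Lp.coeFn_add u v)
      map_smul' := fun c u => by
        rw [RingHom.id_apply, ← MemLp.toLp_const_smul]
        exact MemLp.toLp_congr _ _ (Lp.coeFn_smul c u) }
  have hι (u : Lp ℝ 2 μ) :
      ‖ι u‖ ≤ (μ Set.univ ^ (1 / (1 : ENNReal).toReal - 1 / (2 : ENNReal).toReal)).toReal * ‖u‖ := by
    change ‖(hL u).toLp u‖ ≤ _
    rw [Lp.norm_toLp, Lp.norm_def, mul_comm, ← ENNReal.toReal_mul]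
    refine ENNReal.toReal_mono (ENNReal.mul_ne_top (Lp.eLpNorm_ne_top u)
      (ENNReal.rpow_ne_top_of_nonneg (by norm_num) (measure_ne_top _ _))) ?_
    exact eLpNorm_le_eLpNorm_mul_rpow_measure_univ (by norm_num) (Lp.aestronglyMeasurable u)
  let ψ : StrongDual ℝ (Lp ℝ 2 μ) := φ.comp (ι.mkContinuous _ hι)
  obtain ⟨G, hG⟩ : ∃ G : Lp ℝ 2 μ, ∀ u, inner ℝ G u = ψ u :=
    ⟨(InnerProductSpace.toDual ℝ _).symm ψ, fun u => InnerProductSpace.toDual_symm_apply⟩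
  have hrep (h : α → ℝ) (h2 : MemLp h 2 μ) (h1 : MemLp h 1 μ) :
      φ (h1.toLp h) = ∫ x, h x * G x ∂μ := by
    have hcong : h1.toLp h = ι (h2.toLp h) := MemLp.toLp_congr h1 (hL (h2.toLp h)) h2.coeFn_toLp.symm
    rw [hcong]
    change ψ (h2.toLp h) = _
    rw [← hG, L2.inner_def]
    refine integral_congr_ae ?_
    filter_upwards [h2.coeFn_toLp] with x hx
    simp [hx]
  have hGint : Integrable G μ := memLp_one_iff_integrable.1 (hL G)
  have hset (s : Set α) (hs : MeasurableSet s) : |∫ x in s, G x ∂μ| ≤ μ.real s := by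
    have h2 : MemLp (s.indicator fun _ => (1 : ℝ)) 2 μ :=
      memLp_indicator_const 2 hs 1 (Or.inr (measure_ne_top _ _))
    have heq : φ ((h12 h2).toLp _) = ∫ x in s, G x ∂μ := by
      rw [hrep _ h2, ← integral_indicator hs]
      congr 1 with x
      by_cases hx : x ∈ s <;> simp [hx]
    have hnorm : ‖(h12 h2).toLp _‖ = μ.real s := by
      rw [MemLp.norm_toLp_one, ← integral_indicator_one hs]
      congr 1 with x
      by_cases hx : x ∈ s <;> simp [hx]
    rw [← heq, ← hnorm]
    exact (φ.le_of_opNorm_le hφ _).trans_eq (one_mul _)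
  have hle : ∀ᵐ x ∂μ, G x ≤ 1 :=
    ae_le_of_forall_setIntegral_le hGint (integrable_const 1) fun s hs _ => by
      simpa using (abs_le.1 (hset s hs)).2
  have hge : ∀ᵐ x ∂μ, -1 ≤ G x :=
    ae_le_of_forall_setIntegral_le (integrable_const (-1)) hGint fun s hs _ => by
      simpa using (abs_le.1 (hset s hs)).1
  refine ⟨fun x => max (-1) (min 1 (G x)), ?_, fun x => ⟨le_max_left _ _, by simp⟩, ?_⟩
  · exact measurable_const.max (measurable_const.min (Lp.stronglyMeasurable G).measurable)
  · intro h h2 h1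
    rw [hrep h h2 h1]
    refine integral_congr_ae ?_
    filter_upwards [hle, hge] with x hx1 hx2
    simp [hx1, hx2]

/-- The distance of `x` to a subspace is attained by a functional of norm at most one vanishing on
that subspace. -/
theorem exists_dual_vanishing_of_le_norm_sub {E : Type*} [NormedAddCommGroup E] [NormedSpace ℝ E]
    (V : Submodule ℝ E) (x : E) (r : ℝ) (hr : ∀ v ∈ V, r ≤ ‖v - x‖) :
    ∃ φ : StrongDual ℝ E, ‖φ‖ ≤ 1 ∧ (∀ v ∈ V, φ v = 0) ∧ r ≤ φ x := by
  obtain ⟨ψ, hψ, hψx⟩ := exists_dual_vector'' ℝ (V.mkQ x)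
  have hbound (y : E) : ‖(ψ : E ⧸ V →ₗ[ℝ] ℝ) (V.mkQ y)‖ ≤ 1 * ‖y‖ := by
    rw [one_mul]
    refine (ψ.le_of_opNorm_le hψ _).trans ?_
    rw [one_mul]
    exact Submodule.Quotient.norm_mk_le V y
  refine ⟨((ψ : E ⧸ V →ₗ[ℝ] ℝ).comp V.mkQ).mkContinuous 1 hbound,
    LinearMap.mkContinuous_norm_le _ zero_le_one _, fun v hv => ?_, ?_⟩
  · have : V.mkQ v = 0 := (Submodule.Quotient.mk_eq_zero V).2 hv
    simp [this]
  · change r ≤ ψ (V.mkQ x)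
    rw [hψx]
    refine (QuotientAddGroup.le_norm_iff (S := V.toAddSubgroup)).2 fun y hy => ?_
    have hmem : y - x ∈ V := (Submodule.Quotient.eq V).1 hy
    have := hr (x - y) (by simpa using V.neg_mem hmem)
    simpa using this

end Duality

/-- If every polynomial of degree at most `d-1` is at `L¹(γ_m)`-distance at least `2ε`
from the `±1`-valued function `f`, then there is a `[-1,1]`-valued function `g` with
vanishing moments against all polynomials of degree at most `d-1` which satisfies
`‖g - f‖₁ ≤ 1 - 2ε`. -/
theorem stmt_0 (m : ℕ) (hm : 0 < m) (ε : ℝ) (hε : 0 < ε) (d : ℕ) (hd : 0 < d)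
    (f : (Fin m → ℝ) → ℝ) (hfmeas : Measurable f)
    (hfval : ∀ x, f x = 1 ∨ f x = -1)
    (hfar : ∀ p : MvPolynomial (Fin m) ℝ, p.totalDegree ≤ d - 1 →
      2 * ε ≤ ∫ x, |MvPolynomial.eval x p - f x| ∂(gaussian m)) :
    ∃ g : (Fin m → ℝ) → ℝ, Measurable g ∧ (∀ x, g x ∈ Set.Icc (-1 : ℝ) 1) ∧
      (∀ P : MvPolynomial (Fin m) ℝ, P.totalDegree ≤ d - 1 →
        ∫ x, MvPolynomial.eval x P * g x ∂(gaussian m) = 0) ∧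
      ∫ x, |g x - f x| ∂(gaussian m) ≤ 1 - 2 * ε := by
  have hf (q : ENNReal) : MemLp f q (gaussian m) :=
    MemLp.of_bound hfmeas.aestronglyMeasurable 1
      (.of_forall fun x => by rcases hfval x with h | h <;> simp [h])
  have hp (p : MvPolynomial (Fin m) ℝ) : MemLp (fun x => MvPolynomial.eval x p) 1 (gaussian m) :=
    memLp_one_iff_integrable.2 (integrable_eval_gaussian p)
  let T : MvPolynomial (Fin m) ℝ →ₗ[ℝ] Lp ℝ 1 (gaussian m) :=
    { toFun := fun p => (hp p).toLp _
      map_add' := fun p q => by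
        rw [← MemLp.toLp_add]
        exact MemLp.toLp_congr _ _ (.of_forall fun x => by simp)
      map_smul' := fun c p => by
        rw [RingHom.id_apply, ← MemLp.toLp_const_smul]
        exact MemLp.toLp_congr _ _ (.of_forall fun x => by simp) }
  obtain ⟨φ, hφ, hφV, hφf⟩ := exists_dual_vanishing_of_le_norm_sub
    ((MvPolynomial.restrictTotalDegree (Fin m) ℝ (d - 1)).map T) ((hf 1).toLp f) (2 * ε) (by
      rintro _ ⟨p, hpd, rfl⟩
      change _ ≤ ‖(hp p).toLp _ - (hf 1).toLp f‖
      rw [← MemLp.toLp_sub, MemLp.norm_toLp_one]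
      exact hfar p ((MvPolynomial.mem_restrictTotalDegree _ _ _).1 hpd))
  obtain ⟨g, hg, hgI, hrep⟩ := exists_measurable_bounded_repr φ hφ
  refine ⟨g, hg, hgI, fun P hP => ?_, ?_⟩
  · rw [← hrep _ (memLp_two_eval_gaussian P) (hp P)]
    exact hφV _ ⟨P, (MvPolynomial.mem_restrictTotalDegree _ _ _).2 hP, rfl⟩
  · rw [hrep f (hf 2) (hf 1)] at hφf
    have habs (x : Fin m → ℝ) : |g x - f x| = 1 - f x * g x := by
      obtain ⟨h1, h2⟩ := hgI x
      rcases hfval x with h | h <;> rw [h]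
      · rw [abs_of_nonpos (by linarith)]; ring
      · rw [abs_of_nonneg (by linarith)]; ring
    have hint : Integrable (fun x => f x * g x) (gaussian m) := by
      refine Integrable.of_bound (hfmeas.mul hg).aestronglyMeasurable 1 (.of_forall fun x => ?_)
      have := abs_le.2 (hgI x)
      rcases hfval x with h | h <;> simpa [h] using this
    simp_rw [habs]
    rw [integral_sub (integrable_const 1) hint]
    simp only [integral_const, probReal_univ, smul_eq_mul, mul_one]
    linarith
end

section
/- There exist universal constants c₁, c₂, c₃ > 0 such that for every positive integer d there exist a probability distribution D on ℝ and a real number a with c₁/√d ≤ a ≤ c₂/√d satisfying: (i) the moments of D of all orders up to d agree with the corresponding moments of the standard Gaussian γ₁; (ii) D has a density g with respect to Lebesgue measure satisfying g(x) ≤ 2 φ₁(x) for all x ∈ ℝ, where φ₁ is the standard Gaussian density; and (iii) Pr_{X∼D}[(X mod a) ∈ (a/2, a)] ≤ 2^{−c₃ d}, where X mod a denotes the representative of X modulo a lying in [0, a). -/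
open MeasureTheory ProbabilityTheory

open Polynomial in
/-- The weighted coefficient norm `∑ j, |p j| * ρ ^ j` of a real polynomial. -/
noncomputable def coeffNorm (ρ : ℝ) (p : ℝ[X]) : ℝ := p.sum fun j c => |c| * ρ ^ j

namespace coeffNorm
open Polynomial

variable {ρ : ℝ}

lemma eq_sum_range (p : ℝ[X]) {n : ℕ} (hn : p.natDegree < n) :
    coeffNorm ρ p = ∑ j ∈ Finset.range n, |p.coeff j| * ρ ^ j :=
  p.sum_over_range' (by simp) n hn

lemma nonneg (hρ : 0 ≤ ρ) (p : ℝ[X]) : 0 ≤ coeffNorm ρ p :=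
  Finset.sum_nonneg fun _ _ => by positivity

lemma sub_le (hρ : 0 ≤ ρ) (p q : ℝ[X]) :
    coeffNorm ρ (p - q) ≤ coeffNorm ρ p + coeffNorm ρ q := by
  have h := natDegree_sub_le p q
  rw [eq_sum_range (n := max p.natDegree q.natDegree + 1) (p - q) (by lia),
    eq_sum_range (n := max p.natDegree q.natDegree + 1) p (by lia),
    eq_sum_range (n := max p.natDegree q.natDegree + 1) q (by lia), ← Finset.sum_add_distrib]
  refine Finset.sum_le_sum fun j _ => ?_
  rw [← add_mul, coeff_sub]
  gcongr
  exact abs_sub _ _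

lemma C_mul (c : ℝ) (p : ℝ[X]) : coeffNorm ρ (C c * p) = |c| * coeffNorm ρ p := by
  have h := natDegree_C_mul_le c p
  rw [eq_sum_range (n := p.natDegree + 1) (C c * p) (by lia),
    eq_sum_range (n := p.natDegree + 1) p (by lia), Finset.mul_sum]
  simp [abs_mul, mul_assoc]

lemma X_mul (p : ℝ[X]) : coeffNorm ρ (X * p) = ρ * coeffNorm ρ p := by
  have h : (X * p).natDegree ≤ 1 + p.natDegree := natDegree_mul_le.trans (by simp)
  rw [eq_sum_range (n := p.natDegree + 1 + 1) (X * p) (by lia),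
    eq_sum_range (n := p.natDegree + 1) p (by lia), Finset.sum_range_succ', Finset.mul_sum]
  simp only [coeff_X_mul, mul_coeff_zero, coeff_X_zero, zero_mul, abs_zero, add_zero]
  exact Finset.sum_congr rfl fun j _ => by ring

lemma derivative_le (hρ : 0 < ρ) (p : ℝ[X]) {m : ℕ} (hm : p.natDegree ≤ m) :
    coeffNorm ρ (derivative p) ≤ m / ρ * coeffNorm ρ p := by
  have h := natDegree_derivative_le p
  rw [eq_sum_range (n := m + 1) (derivative p) (by lia), Finset.sum_range_succ,
    coeff_derivative, coeff_eq_zero_of_natDegree_lt (p := p) (n := m + 1) (by lia),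
    eq_sum_range (n := m + 1) p (by lia), Finset.sum_range_succ',
    mul_add (m / ρ : ℝ), Finset.mul_sum (Finset.range m)]
  simp only [zero_mul, abs_zero, add_zero]
  refine le_add_of_le_of_nonneg (Finset.sum_le_sum fun j hj => ?_) (by positivity)
  have hj' : ((j : ℝ) + 1) ≤ m := by exact_mod_cast Finset.mem_range.1 hj
  rw [coeff_derivative, abs_mul, abs_of_nonneg (by positivity : (0 : ℝ) ≤ j + 1)]
  calc |p.coeff (j + 1)| * (j + 1) * ρ ^ j ≤ |p.coeff (j + 1)| * m * ρ ^ j := by gcongr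
    _ = m / ρ * (|p.coeff (j + 1)| * ρ ^ (j + 1)) := by field_simp; ring

lemma prod_X_sub_C_le {ι : Type*} (hρ : 0 ≤ ρ) (s : Finset ι) (x : ι → ℝ) (c : ι → ℝ) :
    coeffNorm ρ (∏ i ∈ s, C (c i) * (X - C (x i))) ≤ ∏ i ∈ s, |c i| * (ρ + |x i|) := by
  classical
  induction s using Finset.induction_on with
  | empty => simp [coeffNorm, sum_def, ← C_1, -map_one]
  | insert i s hi ih =>
    rw [Finset.prod_insert hi, Finset.prod_insert hi, mul_assoc, C_mul, sub_mul, mul_assoc]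
    gcongr
    calc _ ≤ _ := sub_le hρ _ _
      _ = (ρ + |x i|) * coeffNorm ρ (∏ i ∈ s, C (c i) * (X - C (x i))) := by
        rw [X_mul, C_mul]; ring
      _ ≤ _ := by gcongr

lemma abs_eval_le (p : ℝ[X]) {x B : ℝ} {m : ℕ} (hm : p.natDegree ≤ m)
    (hx : ∀ j ≤ m, |x| ^ j ≤ ρ ^ j * B) : |p.eval x| ≤ coeffNorm ρ p * B := by
  rw [eval_eq_sum_range' (n := m + 1) (by lia), eq_sum_range (n := m + 1) p (by lia),
    Finset.sum_mul]
  refine (Finset.abs_sum_le_sum_abs _ _).trans (Finset.sum_le_sum fun j hj => ?_)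
  rw [abs_mul, abs_pow, mul_assoc]
  gcongr
  exact hx j (by simpa [Nat.lt_succ_iff] using hj)

end coeffNorm

lemma prod_abs_sub_eq_factorial {i n : ℕ} (hi : i < n) :
    ∏ j ∈ (Finset.range n).erase i, |(i : ℝ) - j| = (i.factorial * (n - 1 - i).factorial : ℕ) := by
  induction n, (Nat.succ_le_of_lt hi) using Nat.le_induction with
  | base =>
    have : (Finset.range (i + 1)).erase i = Finset.range i := by
      ext j; simp; lia
    rw [Nat.succ_eq_add_one, this, ← Finset.prod_range_add_one_eq_factorial,
      ← Finset.prod_range_reflect]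
    simp only [Nat.add_sub_cancel, Nat.sub_self, Nat.factorial_zero, mul_one]
    push_cast
    refine Finset.prod_congr rfl fun j hj => ?_
    have := Finset.mem_range.1 hj
    rw [Nat.sub_sub, Nat.cast_sub (by lia), sub_sub_cancel, abs_of_nonneg (by positivity)]
    push_cast
    ring
  | succ n hn ih =>
    have h : (Finset.range (n + 1)).erase i = insert n ((Finset.range n).erase i) := by
      ext j; simp; lia
    rw [h, Finset.prod_insert (by simp), ih (by lia)]
    obtain ⟨k, rfl⟩ := Nat.exists_eq_add_of_le hn
    have h1 : i + 1 + k + 1 - 1 - i = k + 1 := by lia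
    have h2 : i + 1 + k - 1 - i = k := by lia
    rw [h1, h2, Nat.factorial_succ, abs_sub_comm,
      abs_of_nonneg (by push_cast; linarith [k.cast_nonneg (α := ℝ)])]
    push_cast; ring

/-- Integrating against an antiperiodic function of antiperiod `h` gains a factor `h / 2` when
passing from `f` to its derivative. -/
lemma abs_integral_mul_le_of_antiperiodic {s f f' : ℝ → ℝ} {h M : ℝ} (hh : 0 ≤ h)
    (hs : Measurable s) (hs1 : ∀ x, |s x| ≤ 1) (hsh : Function.Antiperiodic s h)
    (hf : Integrable f) (hf' : Integrable f') (hc : Continuous f')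
    (hd : ∀ x, HasDerivAt f (f' x) x) (hM : ∀ t, |∫ x, s (x - t) * f' x| ≤ M) :
    |∫ x, s x * f x| ≤ h / 2 * M := by
  have bdd : ∀ {u : ℝ → ℝ}, Integrable u → Integrable fun x => s x * u x := fun hu =>
    hu.bdd_mul (c := 1) hs.aestronglyMeasurable (.of_forall hs1)
  have e1 : ∫ x, s x * f (x + h) = -∫ x, s x * f x := by
    rw [← integral_sub_right_eq_self (fun x => s x * f (x + h)) h, ← integral_neg]
    refine integral_congr_ae (.of_forall fun x => ?_)
    simp [hsh.sub_eq]
  have e2 : ∀ x, f (x + h) - f x = ∫ t in (0 : ℝ)..h, f' (x + t) := fun x => by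
    rw [intervalIntegral.integral_comp_add_left, add_zero,
      intervalIntegral.integral_eq_sub_of_hasDerivAt (fun y _ => hd y) (hc.intervalIntegrable _ _)]
  have hint : Integrable (Function.uncurry fun x t => s x * f' (x + t))
      (volume.prod (volume.restrict (Set.uIoc 0 h))) := by
    have hm : AEStronglyMeasurable (Function.uncurry fun x t => s x * f' (x + t))
        (volume.prod (volume.restrict (Set.uIoc 0 h))) := by
      refine Measurable.aestronglyMeasurable ?_
      exact (hs.comp measurable_fst).mul
        (hc.measurable.comp (measurable_fst.add measurable_snd))
    rw [integrable_prod_iff' hm]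
    refine ⟨.of_forall fun t => bdd (hf'.comp_add_right t), ?_⟩
    have : IsFiniteMeasure (volume.restrict (Set.uIoc 0 h)) := ⟨by simp [Set.uIoc]⟩
    refine .of_bound ?_ (∫ x, |f' x|) ?_
    · exact hm.norm.prod_swap.integral_prod_right'
    · refine .of_forall fun t => ?_
      rw [Real.norm_of_nonneg (integral_nonneg fun _ => norm_nonneg _)]
      rw [← integral_add_right_eq_self (fun x => |f' x|) t]
      refine integral_mono (bdd (hf'.comp_add_right t)).norm (hf'.comp_add_right t).abs fun x => ?_
      simp only [Function.uncurry, norm_mul, Real.norm_eq_abs]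
      exact mul_le_of_le_one_left (abs_nonneg _) (hs1 x)
  have e3 : ∫ x, s x * (f (x + h) - f x) = ∫ t in (0 : ℝ)..h, ∫ x, s (x - t) * f' x := by
    simp only [e2, ← intervalIntegral.integral_const_mul]
    rw [← intervalIntegral_integral_swap]
    · refine intervalIntegral.integral_congr fun t _ => ?_
      rw [← integral_sub_right_eq_self (fun x => s x * f' (x + t)) t]
      simp
    · exact hint.swap
  have e4 : ∫ x, s x * (f (x + h) - f x) = -2 * ∫ x, s x * f x := by
    simp only [mul_sub]
    rw [integral_sub (bdd (hf.comp_add_right h)) (bdd hf), e1]; ring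
  have e5 := intervalIntegral.norm_integral_le_of_norm_le_const
    (a := 0) (b := h) (f := fun t => ∫ x, s (x - t) * f' x) (C := M) fun t _ => hM t
  rw [← e3, e4, sub_zero, abs_of_nonneg hh, norm_mul] at e5
  norm_num at e5
  linarith

section GaussianMoments
open Polynomial

lemma gaussianPDFReal_zero_one (x : ℝ) :
    gaussianPDFReal 0 1 x = (Real.sqrt (2 * Real.pi))⁻¹ * Real.exp (-(x ^ 2) / 2) := by
  simp [gaussianPDFReal]

lemma continuous_gaussianPDFReal_zero_one : Continuous (gaussianPDFReal 0 1) := by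
  rw [funext gaussianPDFReal_zero_one]
  fun_prop

lemma hasDerivAt_eval_mul_gaussianPDFReal (p : ℝ[X]) (x : ℝ) :
    HasDerivAt (fun x => p.eval x * gaussianPDFReal 0 1 x)
      ((derivative p - X * p).eval x * gaussianPDFReal 0 1 x) x := by
  simp only [gaussianPDFReal_zero_one]
  have h : HasDerivAt (fun x : ℝ => -(x ^ 2) / 2) (-x) x :=
    ((hasDerivAt_pow 2 x).neg.div_const 2).congr_deriv (by simp; ring)
  refine ((p.hasDerivAt x).mul (h.exp.const_mul (Real.sqrt (2 * Real.pi))⁻¹)).congr_deriv ?_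
  simp only [eval_sub, eval_mul, eval_X]
  ring

lemma abs_pow_le_mul_exp {d : ℕ} (hd : 0 < d) (x : ℝ) {j : ℕ} (hj : j ≤ 2 * d) :
    |x| ^ j ≤ (2 * √(d : ℝ)) ^ j * Real.exp (x ^ 2 / 4) := by
  have hd' : (0 : ℝ) < √(d : ℝ) := by positivity
  have hsq : √(d : ℝ) ^ 2 = d := Real.sq_sqrt d.cast_nonneg
  set y := |x| / (2 * √(d : ℝ)) with hy
  have hx : |x| = 2 * √(d : ℝ) * y := by rw [hy]; field_simp
  have hy0 : 0 ≤ y := by positivity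
  rw [hx, mul_pow]
  gcongr
  calc y ^ j ≤ √(1 + y ^ 2) ^ j := by
        gcongr
        exact Real.le_sqrt_of_sq_le (by linarith)
    _ ≤ √(1 + y ^ 2) ^ (2 * d) :=
        pow_le_pow_right₀ (Real.one_le_sqrt.2 (by nlinarith)) hj
    _ = (y ^ 2 + 1) ^ d := by rw [pow_mul, Real.sq_sqrt (by positivity), add_comm]
    _ ≤ Real.exp (y ^ 2) ^ d := by gcongr; exact Real.add_one_le_exp _
    _ = Real.exp (x ^ 2 / 4) := by
        rw [← Real.exp_nat_mul, ← sq_abs x, hx, mul_pow, mul_pow, hsq]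
        congr 1; ring

lemma abs_eval_mul_gaussianPDFReal_le {d : ℕ} (hd : 0 < d) {p : ℝ[X]}
    (hp : p.natDegree ≤ 2 * d) (x : ℝ) :
    |p.eval x * gaussianPDFReal 0 1 x| ≤
      coeffNorm (2 * √(d : ℝ)) p * ((√(2 * Real.pi))⁻¹ * Real.exp (-(1 / 4) * x ^ 2)) := by
  rw [abs_mul, abs_of_nonneg (gaussianPDFReal_nonneg _ _ _), gaussianPDFReal_zero_one]
  calc _ ≤ coeffNorm (2 * √(d : ℝ)) p * Real.exp (x ^ 2 / 4) *
        ((√(2 * Real.pi))⁻¹ * Real.exp (-(x ^ 2) / 2)) := by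
        gcongr
        exact coeffNorm.abs_eval_le p hp fun j hj => abs_pow_le_mul_exp hd x hj
    _ = _ := by
        have : Real.exp (-(1 / 4) * x ^ 2) = Real.exp (x ^ 2 / 4) * Real.exp (-(x ^ 2) / 2) := by
          rw [← Real.exp_add]; congr 1; ring
        rw [this]; ring

lemma integrable_eval_mul_gaussianPDFReal (p : ℝ[X]) :
    Integrable fun x => p.eval x * gaussianPDFReal 0 1 x := by
  refine (((integrable_exp_neg_mul_sq (b := 1 / 4) (by norm_num)).const_mul _).const_mul _).mono'
    ?_ (.of_forall fun x =>
      abs_eval_mul_gaussianPDFReal_le (d := p.natDegree + 1) (by lia) (by lia) x)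
  exact (p.continuous.measurable.mul (measurable_gaussianPDFReal 0 1)).aestronglyMeasurable

lemma integral_abs_eval_mul_gaussianPDFReal_le {d : ℕ} (hd : 0 < d) {p : ℝ[X]}
    (hp : p.natDegree ≤ 2 * d) :
    ∫ x, |p.eval x * gaussianPDFReal 0 1 x| ≤ 2 * coeffNorm (2 * √(d : ℝ)) p := by
  have hi := integrable_exp_neg_mul_sq (b := 1 / 4) (by norm_num)
  refine (integral_mono (integrable_eval_mul_gaussianPDFReal p).abs
    ((hi.const_mul _).const_mul _) (abs_eval_mul_gaussianPDFReal_le hd hp)).trans ?_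
  rw [integral_const_mul, integral_const_mul, integral_gaussian,
    mul_comm 2 (coeffNorm _ p)]
  refine mul_le_mul_of_nonneg_left ?_
    (coeffNorm.nonneg (ρ := 2 * √(d : ℝ)) (by positivity) p)
  rw [inv_mul_le_iff₀ (by positivity)]
  refine Real.sqrt_le_iff.2 ⟨by positivity, ?_⟩
  rw [mul_pow, Real.sq_sqrt (by positivity)]
  linarith [Real.pi_pos]

lemma abs_integral_antiperiodic_mul_gaussianPDFReal_le {d : ℕ} (hd : 0 < d) {h : ℝ} (hh : 0 ≤ h)
    (n : ℕ) {p : ℝ[X]} (hp : p.natDegree + n ≤ 2 * d) {s : ℝ → ℝ} (hs : Measurable s)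
    (hs1 : ∀ x, |s x| ≤ 1) (hsh : Function.Antiperiodic s h) :
    |∫ x, s x * (p.eval x * gaussianPDFReal 0 1 x)| ≤
      (h / 2 * (3 * √(d : ℝ))) ^ n * (2 * coeffNorm (2 * √(d : ℝ)) p) := by
  induction n generalizing p s with
  | zero =>
    rw [pow_zero, one_mul]
    refine le_trans ?_ (integral_abs_eval_mul_gaussianPDFReal_le hd hp)
    refine (abs_integral_le_integral_abs).trans ?_
    refine integral_mono_of_nonneg (.of_forall fun _ => abs_nonneg _)
      (integrable_eval_mul_gaussianPDFReal p).abs (.of_forall fun x => ?_)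
    simp only [abs_mul (s x)]
    exact mul_le_of_le_one_left (abs_nonneg _) (hs1 x)
  | succ n ih =>
    have hd' : (0 : ℝ) < √(d : ℝ) := by positivity
    have hdeg : (derivative p - X * p).natDegree + n ≤ 2 * d := by
      have h1 := natDegree_sub_le (derivative p) (X * p)
      have h2 := natDegree_derivative_le p
      have h3 : (X * p).natDegree ≤ 1 + p.natDegree := natDegree_mul_le.trans (by simp)
      have h4 := max_le_iff.2 ⟨h2.trans (by lia : _ ≤ 1 + p.natDegree), h3⟩
      lia
    have hN : coeffNorm (2 * √(d : ℝ)) (derivative p - X * p) ≤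
        3 * √(d : ℝ) * coeffNorm (2 * √(d : ℝ)) p := by
      refine (coeffNorm.sub_le (by positivity) _ _).trans ?_
      rw [coeffNorm.X_mul]
      have := coeffNorm.derivative_le (ρ := 2 * √(d : ℝ)) (by positivity) p
        (m := 2 * d) (by lia)
      have e : ((2 * d : ℕ) : ℝ) / (2 * √(d : ℝ)) = √(d : ℝ) := by
        push_cast
        rw [mul_div_mul_left _ _ two_ne_zero, Real.div_sqrt]
      rw [e] at this
      linarith
    have key := abs_integral_mul_le_of_antiperiodic hh hs hs1 hsh
      (integrable_eval_mul_gaussianPDFReal p)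
      (integrable_eval_mul_gaussianPDFReal (derivative p - X * p))
      ((Polynomial.continuous _).mul continuous_gaussianPDFReal_zero_one)
      (hasDerivAt_eval_mul_gaussianPDFReal p)
      (fun t => ih hdeg (s := fun x => s (x - t)) (hs.comp (measurable_id.sub_const t))
        (fun x => hs1 _) (fun x => by simpa only [add_sub_right_comm] using hsh (x - t)))
    refine key.trans ?_
    calc _ ≤ h / 2 * ((h / 2 * (3 * √(d : ℝ))) ^ n *
          (2 * (3 * √(d : ℝ) * coeffNorm (2 * √(d : ℝ)) p))) := by gcongr
      _ = _ := by ring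

end GaussianMoments

section StepFunction
open Polynomial

lemma pow_div_factorial_le (d : ℕ) : ((d : ℝ) + 1) ^ d / d.factorial ≤ 3 ^ (d + 1) := by
  have h := Real.pow_div_factorial_le_exp (x := (d : ℝ) + 1) (by positivity) (d + 1)
  have h3 : Real.exp ((d : ℝ) + 1) ≤ 3 ^ (d + 1) := by
    have : Real.exp ((d : ℝ) + 1) = Real.exp 1 ^ (d + 1) := by
      rw [← Real.exp_nat_mul]; push_cast; simp
    rw [this]
    gcongr
    exact Real.exp_one_lt_three.le
  refine le_trans (le_of_eq ?_) (h.trans h3)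
  rw [Nat.factorial_succ, pow_succ]
  push_cast
  field_simp

lemma coeffNorm_lagrange_basis_le {ρ : ℝ} (hρ : 0 < ρ) {d i : ℕ} (hi : i ≤ d) :
    coeffNorm ρ (Lagrange.basis (Finset.range (d + 1)) (fun j => ρ * (j + 1) / (d + 1)) i) ≤
      3 * 12 ^ d := by
  refine (coeffNorm.prod_X_sub_C_le hρ.le _ _ _).trans ?_
  have hcard : ((Finset.range (d + 1)).erase i).card = d := by
    rw [Finset.card_erase_of_mem (by simp; lia)]; simp
  have hfac := prod_abs_sub_eq_factorial (i := i) (n := d + 1) (by lia)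
  rw [Nat.add_sub_cancel] at hfac
  have hchoose : (d.factorial : ℝ) ≤ 2 ^ d * (i.factorial * (d - i).factorial : ℕ) := by
    rw [← Nat.choose_mul_factorial_mul_factorial hi, mul_assoc]
    push_cast
    gcongr
    exact_mod_cast Nat.choose_le_two_pow d i
  have hpos : (0 : ℝ) < (i.factorial * (d - i).factorial : ℕ) := by positivity
  calc _ ≤ ∏ j ∈ (Finset.range (d + 1)).erase i, 2 * ((d : ℝ) + 1) / |(i : ℝ) - j| := by
        refine Finset.prod_le_prod (fun _ _ => by positivity) fun j hj => ?_
        obtain ⟨hji, hjd⟩ := Finset.mem_erase.1 hj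
        have hjd' : (j : ℝ) + 1 ≤ d + 1 := by exact_mod_cast Finset.mem_range.1 hjd
        have hij : 0 < |(i : ℝ) - j| :=
          abs_pos.2 (sub_ne_zero.2 (by exact_mod_cast hji.symm))
        have e1 : ρ * ((i : ℝ) + 1) / (d + 1) - ρ * ((j : ℝ) + 1) / (d + 1) =
            ρ / (d + 1) * (i - j) := by ring
        have e2 : |ρ * ((j : ℝ) + 1) / (d + 1)| ≤ ρ := by
          rw [abs_of_nonneg (by positivity), div_le_iff₀ (by positivity)]
          gcongr
        rw [e1, abs_inv, abs_mul, abs_of_nonneg (by positivity : 0 ≤ ρ / ((d : ℝ) + 1))]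
        calc _ ≤ (ρ / (d + 1) * |(i : ℝ) - j|)⁻¹ * (ρ + ρ) := by gcongr
          _ = _ := by field_simp; ring
    _ = (2 * ((d : ℝ) + 1)) ^ d / (i.factorial * (d - i).factorial : ℕ) := by
        rw [Finset.prod_div_distrib, hfac, Finset.prod_const, hcard]
    _ ≤ (2 * ((d : ℝ) + 1)) ^ d * 2 ^ d / d.factorial := by
        rw [div_le_div_iff₀ hpos (by positivity), mul_assoc]
        gcongr
    _ = 4 ^ d * (((d : ℝ) + 1) ^ d / d.factorial) := by
        rw [mul_pow, show (4 : ℝ) = 2 * 2 by norm_num, mul_pow]; ring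
    _ ≤ 4 ^ d * 3 ^ (d + 1) := by gcongr; exact pow_div_factorial_le d
    _ = _ := by rw [show (12 : ℝ) = 4 * 3 by norm_num, mul_pow]; ring

/-- A step function supported on `(0, ρ]` with prescribed moments up to order `d`, bounded at an
exponential loss in `d`. -/
lemma exists_stepFunction_integral_mul_pow {ρ : ℝ} (hρ : 0 < ρ) (d : ℕ) {K : ℝ}
    (Λ : ℝ[X] →ₗ[ℝ] ℝ) (hΛ : ∀ p : ℝ[X], p.natDegree ≤ d → |Λ p| ≤ K * coeffNorm ρ p)
    (hK : 0 ≤ K) :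
    ∃ T : ℝ → ℝ, Measurable T ∧ (∀ x ∉ Set.Ioc 0 ρ, T x = 0) ∧
      (∀ x, |T x| ≤ (d + 1) ^ 2 / ρ * (K * (3 * 12 ^ d))) ∧
      ∀ j ≤ d, ∫ x, T x * x ^ j = Λ (X ^ j) / (j + 1) := by
  set v : ℕ → ℝ := fun j => ρ * (j + 1) / (d + 1) with hv
  set ℓ : ℕ → ℝ[X] := fun i => Lagrange.basis (Finset.range (d + 1)) v i with hℓ
  have hv0 : ∀ i, 0 < v i := fun i => by positivity
  have hvinj : Set.InjOn v (Finset.range (d + 1)) := fun i _ j _ hij => by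
    have : (i : ℝ) = j := by
      simp only [hv] at hij
      field_simp at hij
      linarith
    exact_mod_cast this
  refine ⟨fun x => ∑ i ∈ Finset.range (d + 1),
    Λ (ℓ i) / v i * (Set.Ioc 0 (v i)).indicator (fun _ => (1 : ℝ)) x, ?_, ?_, ?_, ?_⟩
  · exact Finset.measurable_sum _ fun i _ =>
      (measurable_const.indicator measurableSet_Ioc).const_mul _
  · intro x hx
    refine Finset.sum_eq_zero fun i hi => ?_
    have hi' : (i : ℝ) + 1 ≤ d + 1 := by exact_mod_cast Finset.mem_range.1 hi
    have hvi : v i ≤ ρ := by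
      simp only [hv]
      rw [div_le_iff₀ (by positivity)]
      gcongr
    rw [Set.indicator_of_notMem (fun h => hx ⟨h.1, h.2.trans hvi⟩), mul_zero]
  · intro x
    refine (Finset.abs_sum_le_sum_abs _ _).trans ?_
    calc _ ≤ ∑ i ∈ Finset.range (d + 1), (d + 1) / ρ * (K * (3 * 12 ^ d)) := by
          refine Finset.sum_le_sum fun i hi => ?_
          have hid : i ≤ d := Nat.lt_succ_iff.1 (Finset.mem_range.1 hi)
          have h1 : |(Set.Ioc 0 (v i)).indicator (fun _ => (1 : ℝ)) x| ≤ 1 := by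
            by_cases h : x ∈ Set.Ioc 0 (v i) <;> simp [h]
          have h2 : |Λ (ℓ i)| ≤ K * (3 * 12 ^ d) := by
            refine (hΛ _ ?_).trans ?_
            · rw [Lagrange.natDegree_basis hvinj hi]; simp
            · gcongr
              exact coeffNorm_lagrange_basis_le hρ hid
          have h3 : (v i)⁻¹ ≤ (d + 1) / ρ := by
            rw [← inv_div]
            gcongr
            simp only [hv]
            gcongr
            exact le_mul_of_one_le_right hρ.le (by linarith [i.cast_nonneg (α := ℝ)])
          rw [abs_mul, div_eq_mul_inv, abs_mul, abs_of_nonneg (inv_nonneg.2 (hv0 i).le)]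
          calc _ ≤ K * (3 * 12 ^ d) * ((d + 1) / ρ) * 1 := by gcongr
            _ = _ := by ring
      _ = _ := by simp; ring
  · intro j hj
    have hX : (X ^ j : ℝ[X]) = ∑ i ∈ Finset.range (d + 1), v i ^ j • ℓ i := by
      have := Lagrange.eq_interpolate (f := (X ^ j : ℝ[X])) hvinj
        (by rw [degree_X_pow, Finset.card_range]; exact_mod_cast Nat.lt_succ_iff.2 hj)
      rw [this, Lagrange.interpolate_apply]
      simp [smul_eq_C_mul, hℓ]
    have hint : ∀ i, ∫ x, Λ (ℓ i) / v i * (Set.Ioc 0 (v i)).indicator (fun _ => (1 : ℝ)) x * x ^ j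
        = Λ (ℓ i) * v i ^ j / (j + 1) := fun i => by
      have : ∀ x : ℝ, Λ (ℓ i) / v i * (Set.Ioc 0 (v i)).indicator (fun _ => (1 : ℝ)) x * x ^ j =
          Λ (ℓ i) / v i * (Set.Ioc 0 (v i)).indicator (fun x => x ^ j) x := fun x => by
        by_cases h : x ∈ Set.Ioc 0 (v i) <;> simp [h]
      simp only [this]
      rw [integral_const_mul, integral_indicator measurableSet_Ioc,
        ← intervalIntegral.integral_of_le (hv0 i).le, integral_pow]
      have := (hv0 i).ne'
      field_simp
      simp [pow_succ']
      ring
    simp only [Finset.sum_mul]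
    rw [integral_finsetSum]
    · simp only [hint]
      rw [hX, map_sum, Finset.sum_div]
      refine Finset.sum_congr rfl fun i _ => ?_
      rw [map_smul, smul_eq_mul]; ring
    · intro i _
      have : (fun x : ℝ => (Set.Ioc 0 (v i)).indicator (fun _ => (1 : ℝ)) x * x ^ j) =
          (Set.Ioc 0 (v i)).indicator fun x => x ^ j := by
        ext x
        by_cases h : x ∈ Set.Ioc 0 (v i) <;> simp [h]
      simp only [mul_assoc]
      refine Integrable.const_mul ?_ _
      rw [this]
      rw [integrable_indicator_iff measurableSet_Ioc]
      exact ((continuous_pow j).intervalIntegrable 0 (v i)).1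

end StepFunction

section SquareWave

/-- The square wave of period `a`: it is `1` when `x mod a < a / 2` and `-1` otherwise. -/
noncomputable def squareWave (a x : ℝ) : ℝ := if Int.fract (x / a) < 1 / 2 then 1 else -1

lemma measurable_squareWave (a : ℝ) : Measurable (squareWave a) :=
  Measurable.ite (measurableSet_lt (measurable_fract.comp (measurable_id.div_const a))
    measurable_const) measurable_const measurable_const

lemma abs_squareWave_le (a x : ℝ) : |squareWave a x| ≤ 1 := by
  unfold squareWave; split_ifs <;> simp

lemma antiperiodic_squareWave {a : ℝ} (ha : 0 < a) :
    Function.Antiperiodic (squareWave a) (a / 2) := fun x => by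
  have e : (x + a / 2) / a = x / a + 1 / 2 := by field_simp
  have h0 := Int.fract_nonneg (x / a)
  have h1 := Int.fract_lt_one (x / a)
  unfold squareWave
  rw [e]
  by_cases h : Int.fract (x / a) < 1 / 2
  · have : Int.fract (x / a + 1 / 2) = Int.fract (x / a) + 1 / 2 := by
      rw [Int.fract_eq_iff]
      exact ⟨by linarith, by linarith, ⌊x / a⌋, by rw [Int.fract]; ring⟩
    rw [if_pos h, if_neg (by linarith)]
  · have : Int.fract (x / a + 1 / 2) = Int.fract (x / a) - 1 / 2 := by
      rw [Int.fract_eq_iff]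
      exact ⟨by linarith, by linarith, ⌊x / a⌋ + 1, by rw [Int.fract]; push_cast; ring⟩
    rw [if_neg h, if_pos (by linarith), neg_neg]

lemma squareWave_eq_neg_one {a x : ℝ} (ha : 0 < a)
    (hx : x - a * (⌊x / a⌋ : ℝ) ∈ Set.Ioo (a / 2) a) : squareWave a x = -1 := by
  have h : x - a * (⌊x / a⌋ : ℝ) = a * Int.fract (x / a) := by
    rw [Int.fract]; field_simp
  rw [h] at hx
  exact if_neg (by nlinarith [hx.1])

end SquareWave

open Polynomial in
/-- For a suitable period of order `1 / √d`, the moments up to order `d` of the square wave with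
Gaussian weight can be cancelled by a function exponentially small relative to the weight. -/
lemma exists_correction {d : ℕ} (hd : 0 < d) {a : ℝ} (ha : a = 1 / 23328 / √(d : ℝ)) :
    ∃ T : ℝ → ℝ, Measurable T ∧ (∀ x, |T x| ≤ (1 / 4) ^ d * gaussianPDFReal 0 1 x) ∧
      ∀ j ≤ d, ∫ x, T x * x ^ j = -∫ x, squareWave a x * (x ^ j * gaussianPDFReal 0 1 x) := by
  have hd0 : (0 : ℝ) < √(d : ℝ) := by positivity
  have hd1 : (1 : ℝ) ≤ √(d : ℝ) := Real.one_le_sqrt.2 (by exact_mod_cast hd)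
  have hsq : √(d : ℝ) ^ 2 = d := Real.sq_sqrt d.cast_nonneg
  have ha0 : 0 < a := by rw [ha]; positivity
  have hint : ∀ p : ℝ[X], Integrable fun x =>
      squareWave a x * (p.eval x * gaussianPDFReal 0 1 x) := fun p =>
    (integrable_eval_mul_gaussianPDFReal p).bdd_mul (c := 1)
      (measurable_squareWave a).aestronglyMeasurable (.of_forall (abs_squareWave_le a))
  let Λ : ℝ[X] →ₗ[ℝ] ℝ :=
    { toFun := fun p => -∫ x, squareWave a x *
        ((derivative (X * p)).eval x * gaussianPDFReal 0 1 x)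
      map_add' := fun p q => by
        rw [← neg_add, ← integral_add (hint _) (hint _)]
        congr 2 with x
        simp only [mul_add, derivative_add, eval_add]; ring
      map_smul' := fun c p => by
        rw [RingHom.id_apply, smul_eq_mul, mul_neg, ← integral_const_mul]
        congr 2 with x
        simp only [mul_smul_comm, derivative_smul, eval_smul, smul_eq_mul]; ring }
  set δ : ℝ := (1 / 31104) ^ d with hδ
  have hΛ : ∀ p : ℝ[X], p.natDegree ≤ d →
      |Λ p| ≤ δ * (2 * (d + 1)) * coeffNorm (2 * √(d : ℝ)) p := fun p hp => by
    have h3 : (X * p).natDegree ≤ 1 + p.natDegree := natDegree_mul_le.trans (by simp)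
    have h4 := natDegree_derivative_le (X * p)
    have h5 := abs_integral_antiperiodic_mul_gaussianPDFReal_le hd (by positivity) d
      (p := derivative (X * p)) (by lia) (measurable_squareWave a) (abs_squareWave_le a)
      (antiperiodic_squareWave ha0)
    have h6 := coeffNorm.derivative_le (ρ := 2 * √(d : ℝ)) (by positivity) (X * p)
      (m := d + 1) (by lia)
    rw [coeffNorm.X_mul, ← mul_assoc, div_mul_cancel₀ _ (by positivity)] at h6
    have h7 : a / 2 / 2 * (3 * √(d : ℝ)) = 1 / 31104 := by
      rw [ha]; field_simp; norm_num
    rw [h7, ← hδ] at h5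
    refine (abs_neg _).le.trans (h5.trans ?_)
    calc _ ≤ δ * (2 * (((d + 1 : ℕ) : ℝ) * coeffNorm (2 * √(d : ℝ)) p)) := by gcongr
      _ = _ := by push_cast; ring
  obtain ⟨T, hTm, hT0, hTb, hTj⟩ :=
    exists_stepFunction_integral_mul_pow (by positivity) d Λ hΛ (by positivity)
  refine ⟨T, hTm, fun x => ?_, fun j hj => ?_⟩
  · by_cases hx : x ∈ Set.Ioc 0 (2 * √(d : ℝ))
    · refine (hTb x).trans ?_
      have hφ : 1 / 3 * (1 / 9) ^ d ≤ gaussianPDFReal 0 1 x := by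
        rw [gaussianPDFReal_zero_one]
        have h1 : √(2 * Real.pi) ≤ 3 :=
          Real.sqrt_le_iff.2 ⟨by norm_num, by linarith [Real.pi_lt_four]⟩
        have h2 : (3 : ℝ)⁻¹ ≤ (√(2 * Real.pi))⁻¹ := by gcongr
        have h3 : ((1 : ℝ) / 9) ^ d ≤ Real.exp (-(x ^ 2) / 2) := by
          have h4 : Real.exp (-2) ^ d ≤ Real.exp (-(x ^ 2) / 2) := by
            rw [← Real.exp_nat_mul]
            refine Real.exp_le_exp.2 ?_
            have := pow_le_pow_left₀ hx.1.le hx.2 2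
            rw [mul_pow, hsq] at this
            linarith
          refine le_trans ?_ h4
          gcongr
          rw [Real.exp_neg, one_div]
          gcongr
          have : Real.exp 2 = Real.exp 1 ^ 2 := by rw [← Real.exp_nat_mul]; norm_num
          rw [this]
          nlinarith [Real.exp_one_lt_three, Real.exp_pos 1]
        rw [one_div 3]
        gcongr
      refine le_trans ?_ (mul_le_mul_of_nonneg_left hφ (by positivity))
      have h2 : (d : ℝ) + 1 ≤ 2 ^ d := by
        have := one_add_mul_le_pow (a := (1 : ℝ)) (by norm_num) d
        norm_num at this
        linarith
      have h9 : (9 : ℝ) ≤ 9 ^ d := le_self_pow₀ (by norm_num) hd.ne'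
      calc _ = (((d : ℝ) + 1) ^ 3 * (3 * 12 ^ d) * δ) / √(d : ℝ) := by field_simp
        _ ≤ ((d : ℝ) + 1) ^ 3 * (3 * 12 ^ d) * δ := div_le_self (by positivity) hd1
        _ ≤ (2 ^ d) ^ 3 * (3 * 12 ^ d) * δ := by gcongr
        _ = 1 / 3 * (9 * (1 / 324) ^ d) := by
          rw [hδ, ← pow_mul, mul_comm d 3, pow_mul, show (1 / 324 : ℝ) = 2 ^ 3 * 12 * (1 / 31104) by
            norm_num, mul_pow, mul_pow]
          ring
        _ ≤ 1 / 3 * (9 ^ d * (1 / 324) ^ d) := by gcongr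
        _ = _ := by
          rw [← mul_pow, mul_left_comm, ← mul_pow]; norm_num
    · rw [hT0 x hx, abs_zero]
      exact mul_nonneg (by positivity) (gaussianPDFReal_nonneg _ _ _)
  · rw [hTj j hj, div_eq_iff (by positivity)]
    simp only [Λ, LinearMap.coe_mk, AddHom.coe_mk]
    rw [neg_mul, ← integral_mul_const, ← pow_succ']
    congr 2 with x
    simp
    ring

/-- There exist universal constants `c₁, c₂, c₃ > 0` such that for every `d ≥ 1` there are a
probability distribution `D` on `ℝ` and a scale `a` with `c₁/√d ≤ a ≤ c₂/√d` such that: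
(i) all moments of `D` up to order `d` agree with those of `γ₁`; (ii) `D` has a Lebesgue
density `g` with `g ≤ 2φ₁` pointwise; (iii) `Pr_{X∼D}[(X mod a) ∈ (a/2, a)] ≤ 2^(−c₃ d)`. -/
theorem stmt_6 : ∃ c₁ > (0:ℝ), ∃ c₂ > (0:ℝ), ∃ c₃ > (0:ℝ), ∀ d : ℕ, 0 < d →
    ∃ (D : Measure ℝ) (g : ℝ → ℝ) (a : ℝ),
      IsProbabilityMeasure D ∧
      c₁ / Real.sqrt d ≤ a ∧ a ≤ c₂ / Real.sqrt d ∧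
      (∀ j : ℕ, j ≤ d → ∫ x, x ^ j ∂D = ∫ x, x ^ j ∂(gaussianReal 0 1)) ∧
      (∀ x, 0 ≤ g x) ∧
      D = volume.withDensity (fun x => ENNReal.ofReal (g x)) ∧
      (∀ x : ℝ, g x ≤ 2 * ((Real.sqrt (2 * Real.pi))⁻¹ * Real.exp (-(x ^ 2) / 2))) ∧
      (D {x : ℝ | x - a * (⌊x / a⌋ : ℝ) ∈ Set.Ioo (a / 2) a}).toReal ≤
        (2 : ℝ) ^ (-(c₃ * (d : ℝ))) := by
  refine ⟨1 / 23328, by norm_num, 1 / 23328, by norm_num, 1, one_pos, fun d hd => ?_⟩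
  obtain ⟨a, ha⟩ : ∃ a : ℝ, a = 1 / 23328 / √(d : ℝ) := ⟨_, rfl⟩
  obtain ⟨T, hTm, hTb, hTj⟩ := exists_correction hd ha
  have ha0 : 0 < a := by rw [ha]; positivity
  set ε : ℝ := (1 / 4) ^ d with hε
  have hε0 : 0 < ε := by positivity
  have hε1 : ε ≤ 1 := pow_le_one₀ (by norm_num) (by norm_num)
  set φ : ℝ → ℝ := gaussianPDFReal 0 1 with hφ
  have hφ0 : ∀ x, 0 ≤ φ x := gaussianPDFReal_nonneg 0 1
  have hφm : Measurable φ := measurable_gaussianPDFReal 0 1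
  set g : ℝ → ℝ := fun x => φ x + (1 - ε) * (squareWave a x * φ x + T x) with hg
  have hgm : Measurable g :=
    hφm.add ((((measurable_squareWave a).mul hφm).add hTm).const_mul _)
  have hpert : ∀ x, |(1 - ε) * (squareWave a x * φ x + T x)| ≤ φ x := fun x => by
    have h1 : |squareWave a x * φ x + T x| ≤ (1 + ε) * φ x := by
      refine (abs_add_le _ _).trans ?_
      rw [abs_mul, abs_of_nonneg (hφ0 x)]
      have := mul_le_mul_of_nonneg_right (abs_squareWave_le a x) (hφ0 x)
      linarith [hTb x]
    rw [abs_mul, abs_of_nonneg (by linarith)]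
    calc _ ≤ (1 - ε) * ((1 + ε) * φ x) := by gcongr
      _ ≤ φ x := by nlinarith [hφ0 x, mul_nonneg (sq_nonneg ε) (hφ0 x)]
  have hg0 : ∀ x, 0 ≤ g x := fun x => by
    have := neg_le_of_abs_le (hpert x)
    simp only [hg]; linarith
  have hg2 : ∀ x, g x ≤ 2 * φ x := fun x => by
    have := le_of_abs_le (hpert x)
    simp only [hg]; linarith
  have hφi : ∀ j : ℕ, Integrable fun x => x ^ j * φ x := fun j => by
    simpa using integrable_eval_mul_gaussianPDFReal (Polynomial.X ^ j)
  have hsi : ∀ j : ℕ, Integrable fun x => squareWave a x * (x ^ j * φ x) := fun j =>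
    (hφi j).bdd_mul (c := 1) (measurable_squareWave a).aestronglyMeasurable
      (.of_forall (abs_squareWave_le a))
  have hTi : ∀ j : ℕ, Integrable fun x => T x * x ^ j := fun j => by
    refine ((hφi j).abs.const_mul ε).mono' (hTm.mul (measurable_id.pow_const j)).aestronglyMeasurable
      (.of_forall fun x => ?_)
    rw [Real.norm_eq_abs, abs_mul, abs_mul, abs_of_nonneg (hφ0 x)]
    calc _ ≤ ε * φ x * |x ^ j| := by gcongr; exact hTb x
      _ = _ := by ring
  have hmom : ∀ j ≤ d, ∫ x, g x * x ^ j = ∫ x, x ^ j * φ x := fun j hj => by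
    have : ∀ x, g x * x ^ j =
        x ^ j * φ x + (1 - ε) * (squareWave a x * (x ^ j * φ x) + T x * x ^ j) := fun x => by
      simp only [hg]; ring
    simp only [this]
    have hi : Integrable fun x => (1 - ε) * (squareWave a x * (x ^ j * φ x) + T x * x ^ j) :=
      ((hsi j).add (hTi j)).const_mul _
    rw [integral_add (hφi j) hi, integral_const_mul,
      integral_add (hsi j) (hTi j), hTj j hj]
    simp
  have hgi : Integrable g := by
    have := (hφi 0).add (((hsi 0).add (hTi 0)).const_mul (1 - ε))
    simpa [Pi.add_def] using this
  refine ⟨volume.withDensity fun x => ENNReal.ofReal (g x), g, a, ?_, ha.ge, ha.le, ?_, hg0, rfl,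
    fun x => (hg2 x).trans_eq (by rw [hφ, gaussianPDFReal_zero_one]), ?_⟩
  · refine ⟨?_⟩
    rw [withDensity_apply _ MeasurableSet.univ, Measure.restrict_univ,
      ← ofReal_integral_eq_lintegral_ofReal hgi (.of_forall hg0)]
    have := hmom 0 (Nat.zero_le d)
    simp only [pow_zero, mul_one, one_mul] at this
    rw [this, hφ, integral_gaussianPDFReal_eq_one 0 one_ne_zero, ENNReal.ofReal_one]
  · intro j hj
    rw [integral_withDensity_eq_integral_toReal_smul hgm.ennreal_ofReal
      (.of_forall fun _ => ENNReal.ofReal_lt_top), integral_gaussianReal_eq_integral_smul one_ne_zero]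
    simp only [ENNReal.toReal_ofReal (hg0 _), smul_eq_mul]
    rw [hmom j hj]
    simp only [mul_comm, hφ]
  · set S := {x : ℝ | x - a * (⌊x / a⌋ : ℝ) ∈ Set.Ioo (a / 2) a} with hS
    have hSm : MeasurableSet S := by
      refine measurableSet_Ioo.preimage (f := fun x : ℝ => x - a * (⌊x / a⌋ : ℝ)) ?_
      exact measurable_id.sub ((measurable_from_top.comp
        (Int.measurable_floor.comp (measurable_id.div_const a))).const_mul a)
    have hgS : ∀ x ∈ S, g x ≤ 2 * ε * φ x := fun x hx => by
      have h1 := squareWave_eq_neg_one ha0 hx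
      have h2 := mul_le_mul_of_nonneg_left (le_of_abs_le (hTb x)) (sub_nonneg.2 hε1)
      simp only [hg, h1]
      nlinarith [mul_nonneg (sq_nonneg ε) (hφ0 x)]
    have hle : (volume.withDensity fun x => ENNReal.ofReal (g x)) S ≤ ENNReal.ofReal (2 * ε) := by
      rw [withDensity_apply _ hSm]
      calc _ ≤ ∫⁻ x in S, ENNReal.ofReal (2 * ε) * gaussianPDF 0 1 x := by
            refine setLIntegral_mono' hSm fun x hx => ?_
            rw [gaussianPDF, ← ENNReal.ofReal_mul (by positivity)]
            exact ENNReal.ofReal_le_ofReal (hgS x hx)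
        _ ≤ ∫⁻ x, ENNReal.ofReal (2 * ε) * gaussianPDF 0 1 x := setLIntegral_le_lintegral _ _
        _ = _ := by
          rw [lintegral_const_mul _ (measurable_gaussianPDF 0 1),
            lintegral_gaussianPDF_eq_one 0 one_ne_zero, mul_one]
    refine (ENNReal.toReal_le_of_le_ofReal (by positivity) hle).trans ?_
    have h2 : (2 : ℝ) ≤ 2 ^ d := le_self_pow₀ (by norm_num) hd.ne'
    rw [one_mul, Real.rpow_neg (by norm_num), Real.rpow_natCast, ← inv_pow]
    calc 2 * ε ≤ 2 ^ d * ε := by gcongr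
      _ = _ := by rw [hε, ← mul_pow]; norm_num
end

section
/- There is a universal constant c > 0 such that for every integer k ≥ 2 and every ε ∈ (0, 1) with ε ≤ 1/log k, there exists a function f : ℝ^k → {−1, 1} that is an intersection of k halfspaces and satisfies GNS_ε(f) ≥ c √(ε log k). -/
open MeasureTheory ProbabilityTheory

/-- Gaussian noise sensitivity: `GNS_ρ(f) = Pr[f(x) ≠ f(y)]` where `x, z ∼ γ_n` are
independent and `y = (1−ρ)x + √(1−(1−ρ)²) z`. -/
noncomputable def gns (n : ℕ) (ρ : ℝ) (f : (Fin n → ℝ) → ℝ) : ℝ :=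
  (((gaussian n).prod (gaussian n))
    {p : (Fin n → ℝ) × (Fin n → ℝ) |
      f p.1 ≠ f (fun i => (1 - ρ) * p.1 i + Real.sqrt (1 - (1 - ρ) ^ 2) * p.2 i)}).toReal

/-- `f : ℝ^n → {±1}` is an intersection of `k` halfspaces: `f(x) = 1` iff each of `k`
linear threshold functions `sign(⟨wᵢ, x⟩ + θᵢ)` equals `1`. -/
def IsIntersectionOfHalfspaces {n : ℕ} (k : ℕ) (f : (Fin n → ℝ) → ℝ) : Prop :=
  (∀ x, f x = 1 ∨ f x = -1) ∧
  ∃ (w : Fin k → (Fin n → ℝ)) (θ : Fin k → ℝ),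
    ∀ x, f x = 1 ↔ ∀ i, 0 ≤ (∑ j, w i j * x j) + θ i

theorem gaussianReal_real_Ioi_le {t : ℝ} (ht : 0 < t) :
    (gaussianReal 0 1).real (Set.Ioi t) ≤ gaussianPDFReal 0 1 t / t := by
  have hderiv : ∀ x ∈ Set.Ici t,
      HasDerivAt (fun y => gaussianPDFReal 0 1 y / t) (-(x / t * gaussianPDFReal 0 1 x)) x := by
    intro x _
    have h : HasDerivAt (fun y : ℝ => -(y - 0) ^ 2 / (2 * ((1 : NNReal) : ℝ))) (-x) x := by
      have := (((hasDerivAt_id x).sub_const 0).pow 2).neg.div_const (2 * ((1 : NNReal) : ℝ))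
      refine this.congr_deriv ?_
      simp only [NNReal.coe_one, id_eq, Nat.cast_ofNat]
      ring
    refine ((h.exp.const_mul (Real.sqrt (2 * Real.pi * (1 : NNReal)))⁻¹).div_const t).congr_deriv ?_
    rw [gaussianPDFReal]
    ring
  have hlim : Filter.Tendsto (fun y => gaussianPDFReal 0 1 y / t) Filter.atTop (nhds 0) := by
    have h : Filter.Tendsto (fun y : ℝ => -(y - 0) ^ 2 / (2 * ((1 : NNReal) : ℝ)))
        Filter.atTop Filter.atBot := by
      have := (Filter.tendsto_pow_atTop (α := ℝ) two_ne_zero).atTop_div_const (zero_lt_two)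
      refine (Filter.tendsto_neg_atTop_atBot.comp this).congr fun x => ?_
      simp [neg_div]
    have := ((Real.tendsto_exp_atBot.comp h).const_mul
      (Real.sqrt (2 * Real.pi * (1 : NNReal)))⁻¹).div_const t
    simpa [gaussianPDFReal_def] using this
  have hneg : ∀ x ∈ Set.Ioi t, -(x / t * gaussianPDFReal 0 1 x) ≤ 0 := by
    intro x hx
    have hx0 : 0 < x := ht.trans hx
    have := gaussianPDFReal_nonneg 0 1 x
    rw [neg_nonpos]
    positivity
  have hint := integrableOn_Ioi_deriv_of_nonpos' hderiv hneg hlim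
  have heq := integral_Ioi_of_hasDerivAt_of_tendsto' hderiv hint hlim
  rw [integral_neg] at heq
  have hint' : IntegrableOn (fun x => x / t * gaussianPDFReal 0 1 x) (Set.Ioi t) := by
    simpa using hint.neg
  rw [measureReal_def, gaussianReal_apply_eq_integral 0 one_ne_zero,
    ENNReal.toReal_ofReal (integral_nonneg fun x => gaussianPDFReal_nonneg 0 1 x)]
  calc ∫ x in Set.Ioi t, gaussianPDFReal 0 1 x
      ≤ ∫ x in Set.Ioi t, x / t * gaussianPDFReal 0 1 x := by
        refine setIntegral_mono_on (integrable_gaussianPDFReal 0 1).integrableOn hint'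
          measurableSet_Ioi fun x hx => ?_
        have h1 : 1 ≤ x / t := (one_le_div ht).2 (le_of_lt hx)
        nlinarith [gaussianPDFReal_nonneg 0 1 x]
    _ = gaussianPDFReal 0 1 t / t := by linarith

theorem le_gaussianReal_real_Ioc {t d : ℝ} (hd : 0 ≤ d) (hdt : d ≤ 2 * t) :
    d * gaussianPDFReal 0 1 t ≤ (gaussianReal 0 1).real (Set.Ioc (t - d) t) := by
  rw [measureReal_def, gaussianReal_apply_eq_integral 0 one_ne_zero,
    ENNReal.toReal_ofReal (integral_nonneg fun x => gaussianPDFReal_nonneg 0 1 x)]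
  calc d * gaussianPDFReal 0 1 t = ∫ _ in Set.Ioc (t - d) t, gaussianPDFReal 0 1 t := by
        simp [hd]
    _ ≤ ∫ x in Set.Ioc (t - d) t, gaussianPDFReal 0 1 x := by
        refine setIntegral_mono_on (by simp)
          (integrable_gaussianPDFReal 0 1).integrableOn measurableSet_Ioc fun x hx => ?_
        rw [gaussianPDFReal, gaussianPDFReal]
        gcongr _ * Real.exp (-?_ / _)
        simp only [sub_zero]
        exact sq_le_sq' (by linarith [hx.1]) hx.2

theorem gaussianReal_real_Ioi_pos (t : ℝ) : 0 < (gaussianReal 0 1).real (Set.Ioi t) := by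
  refine ENNReal.toReal_pos (fun h => ?_) (measure_ne_top _ _)
  have := gaussianReal_absolutelyContinuous' 0 one_ne_zero h
  simp at this

/-- The `±1`-valued indicator of the orthant `{x | ∀ i, x i ≤ t}`. -/
noncomputable def orthantIndicator (n : ℕ) (t : ℝ) (x : Fin n → ℝ) : ℝ :=
  open Classical in if ∀ i, x i ≤ t then 1 else -1

theorem orthantIndicator_eq_one_iff {n : ℕ} {t : ℝ} {x : Fin n → ℝ} :
    orthantIndicator n t x = 1 ↔ ∀ i, x i ≤ t := by
  unfold orthantIndicator
  split_ifs with h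
  · simpa using h
  · simp only [h, iff_false]
    norm_num

theorem isIntersectionOfHalfspaces_orthantIndicator (n : ℕ) (t : ℝ) :
    IsIntersectionOfHalfspaces n (orthantIndicator n t) := by
  refine ⟨fun x => ?_, fun i j => if i = j then -1 else 0, fun _ => t, fun x => ?_⟩
  · unfold orthantIndicator
    split_ifs <;> simp
  · simp [orthantIndicator_eq_one_iff]

/-- The pairs `(a, b)` such that both `a` and its noisy copy `(1 - ρ) a + √(1 - (1 - ρ)²) b` are at
most `t`. -/
def noiseStableSet (ρ t : ℝ) : Set (ℝ × ℝ) :=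
  {p | p.1 ≤ t ∧ (1 - ρ) * p.1 + Real.sqrt (1 - (1 - ρ) ^ 2) * p.2 ≤ t}

theorem measurableSet_noiseStableSet (ρ t : ℝ) : MeasurableSet (noiseStableSet ρ t) := by
  rw [noiseStableSet, Set.ofPred_and]
  exact (measurableSet_le (by fun_prop) (by fun_prop)).inter
    (measurableSet_le (by fun_prop) (by fun_prop))

theorem le_gns_orthantIndicator (n : ℕ) (ρ t : ℝ) :
    (gaussianReal 0 1).real (Set.Iic t) ^ n -
      ((gaussianReal 0 1).prod (gaussianReal 0 1)).real (noiseStableSet ρ t) ^ n ≤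
    gns n ρ (orthantIndicator n t) := by
  have : IsProbabilityMeasure (gaussian n) := by unfold gaussian; infer_instance
  set A : Set ((Fin n → ℝ) × (Fin n → ℝ)) :=
    (Set.univ.pi fun _ => Set.Iic t) ×ˢ Set.univ with hA
  set B : Set ((Fin n → ℝ) × (Fin n → ℝ)) :=
    {p | ∀ i, (p.1 i, p.2 i) ∈ noiseStableSet ρ t} with hB
  have hBm : MeasurableSet B := by
    rw [hB, Set.ofPred_forall]
    exact MeasurableSet.iInter fun i =>
      (measurableSet_noiseStableSet ρ t).preimage (by fun_prop)
  have hBA : B ⊆ A := fun p hp => ⟨fun i _ => (hp i).1, trivial⟩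
  have hAv : ((gaussian n).prod (gaussian n)).real A =
      (gaussianReal 0 1).real (Set.Iic t) ^ n := by
    rw [hA, measureReal_def, Measure.prod_prod, gaussian, Measure.pi_pi]
    simp [measureReal_def]
  have hBv : ((gaussian n).prod (gaussian n)).real B =
      ((gaussianReal 0 1).prod (gaussianReal 0 1)).real (noiseStableSet ρ t) ^ n := by
    have h := measurePreserving_arrowProdEquivProdArrow ℝ ℝ (Fin n)
      (fun _ => gaussianReal 0 1) (fun _ => gaussianReal 0 1)
    rw [measureReal_def, gaussian, ← h.measure_preimage hBm.nullMeasurableSet]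
    have : MeasurableEquiv.arrowProdEquivProdArrow ℝ ℝ (Fin n) ⁻¹' B =
        Set.univ.pi fun _ => noiseStableSet ρ t := by
      ext p
      simp [hB, MeasurableEquiv.arrowProdEquivProdArrow, Equiv.arrowProdEquivProdArrow]
    rw [this, Measure.pi_pi]
    simp [measureReal_def]
  rw [← hAv, ← hBv, ← measureReal_sdiff hBA hBm]
  refine measureReal_mono fun p hp => ?_
  have h1 : orthantIndicator n t p.1 = 1 :=
    orthantIndicator_eq_one_iff.2 fun i => hp.1.1 i trivial
  simp only [Set.mem_ofPred_eq, h1]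
  intro h2
  exact hp.2 fun i => ⟨hp.1.1 i trivial, orthantIndicator_eq_one_iff.1 h2.symm i⟩

theorem measureReal_noiseStableSet_le {ρ t : ℝ} (hρ : 0 < ρ) (hρ1 : ρ ≤ 1)
    (hρt : ρ * t ≤ 2 * Real.sqrt ρ) :
    ((gaussianReal 0 1).prod (gaussianReal 0 1)).real (noiseStableSet ρ t) ≤
      (gaussianReal 0 1).real (Set.Iic t) -
        (gaussianReal 0 1).real (Set.Ioc (t - Real.sqrt ρ) t) *
          (gaussianReal 0 1).real (Set.Ioi 3) := by
  set s := Real.sqrt ρ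
  have hs : 0 < s := Real.sqrt_pos.2 hρ
  have hsle : s ≤ Real.sqrt (1 - (1 - ρ) ^ 2) := Real.sqrt_le_sqrt (by nlinarith)
  have hdisj : Disjoint (noiseStableSet ρ t) (Set.Ioc (t - s) t ×ˢ Set.Ioi (3 : ℝ)) := by
    rw [Set.disjoint_left]
    rintro ⟨a, b⟩ ⟨-, h1⟩ ⟨⟨h2, h3⟩, h4⟩
    simp only [Set.mem_Ioi] at h1 h2 h3 h4
    have h5 : s * 3 < Real.sqrt (1 - (1 - ρ) ^ 2) * b := by nlinarith
    nlinarith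
  have hunion := measureReal_union (μ := (gaussianReal 0 1).prod (gaussianReal 0 1)) hdisj
    (measurableSet_Ioc.prod measurableSet_Ioi)
  have hmono : ((gaussianReal 0 1).prod (gaussianReal 0 1)).real
      (noiseStableSet ρ t ∪ Set.Ioc (t - s) t ×ˢ Set.Ioi (3 : ℝ)) ≤
      ((gaussianReal 0 1).prod (gaussianReal 0 1)).real (Set.Iic t ×ˢ Set.univ) := by
    refine measureReal_mono ?_
    rintro p (hp | hp)
    · exact ⟨hp.1, trivial⟩
    · exact ⟨hp.1.2, trivial⟩
  rw [measureReal_prod_prod, probReal_univ, mul_one] at hmono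
  rw [measureReal_prod_prod] at hunion
  linarith

theorem one_sub_pow_le_inv {δ : ℝ} (hδ0 : 0 ≤ δ) (hδ1 : δ ≤ 1) (n : ℕ) :
    (1 - δ) ^ n ≤ (1 + n * δ)⁻¹ := by
  rw [← one_div, le_div_iff₀ (by positivity)]
  calc (1 - δ) ^ n * (1 + n * δ) ≤ (1 - δ) ^ n * (1 + δ) ^ n := by
        have := pow_nonneg (sub_nonneg.2 hδ1) n
        gcongr
        exact one_add_mul_le_pow (by linarith) n
    _ = (1 - δ ^ 2) ^ n := by rw [← mul_pow]; ring
    _ ≤ 1 := pow_le_one₀ (by nlinarith) (by nlinarith)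

theorem div_four_le_pow_sub_pow {q r v : ℝ} {k : ℕ} (hk : 0 < k) (hr : 0 ≤ r) (hv0 : 0 ≤ v)
    (hv1 : v ≤ 1) (hq : 1 - 1 / (2 * k) ≤ q) (hq1 : q ≤ 1) (hrq : r ≤ q - v / k) :
    v / 4 ≤ q ^ k - r ^ k := by
  have hk1 : (1 : ℝ) ≤ k := by exact_mod_cast hk
  have hδ0 : 0 ≤ v / k := by positivity
  have hδ1 : v / k ≤ 1 := (div_le_one (by positivity)).2 (by linarith)
  have hk2 : 1 / (2 * (k : ℝ)) ≤ 1 / 2 := by gcongr; linarith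
  have hq0 : 0 ≤ q := by linarith
  have hqk : 1 / 2 ≤ q ^ k := by
    calc (1 : ℝ) / 2 = 1 + k * (-(1 / (2 * k))) := by field_simp; norm_num
      _ ≤ (1 + -(1 / (2 * (k : ℝ)))) ^ k := one_add_mul_le_pow (by linarith) k
      _ ≤ q ^ k := by gcongr <;> linarith
  have hrk : r ^ k ≤ q ^ k * (1 + v)⁻¹ := by
    calc r ^ k ≤ (q * (1 - v / k)) ^ k := by gcongr; nlinarith
      _ = q ^ k * (1 - v / k) ^ k := mul_pow _ _ _
      _ ≤ q ^ k * (1 + k * (v / k))⁻¹ := by gcongr; exact one_sub_pow_le_inv hδ0 hδ1 k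
      _ = q ^ k * (1 + v)⁻¹ := by rw [mul_div_cancel₀ _ (by positivity)]
  have hinv : (1 + v)⁻¹ ≤ 1 - v / 2 := by
    rw [inv_le_iff_one_le_mul₀ (by positivity)]
    nlinarith
  nlinarith

/-- A threshold `t` of order `√(log k)` at which the Gaussian density is proportional to
`√(log k) / k`. -/
theorem exists_gaussianPDFReal_eq {k : ℕ} (hk : 2 ≤ k) :
    ∃ t : ℝ, Real.sqrt (Real.log k) ≤ t ∧ t ≤ 2 * Real.sqrt (Real.log k) ∧
      gaussianPDFReal 0 1 t =
        (Real.sqrt (2 * Real.pi))⁻¹ * (Real.sqrt (Real.log k) / k) := by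
  have hk0 : (0 : ℝ) < k := by positivity
  have hL : 0.69 ≤ Real.log k :=
    (by linarith [Real.log_two_gt_d9] : (0.69 : ℝ) ≤ Real.log 2).trans
      (Real.log_le_log two_pos (by exact_mod_cast hk))
  set L := Real.log k with hLdef
  have hL0 : 0 < L := by linarith
  have h1 : Real.log L ≤ L - 1 := Real.log_le_sub_one_of_pos hL0
  have h2 : -Real.log L ≤ 2 * L := by
    have := Real.log_le_sub_one_of_pos (inv_pos.2 hL0)
    rw [Real.log_inv] at this
    have h3 : L⁻¹ ≤ 1.5 := by
      rw [inv_le_comm₀ hL0 (by norm_num)]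
      norm_num
      linarith
    linarith
  refine ⟨Real.sqrt (2 * L - Real.log L), Real.sqrt_le_sqrt (by linarith), ?_, ?_⟩
  · rw [Real.sqrt_le_left (by positivity), mul_pow, Real.sq_sqrt hL0.le]
    linarith
  · rw [gaussianPDFReal, sub_zero, Real.sq_sqrt (by linarith)]
    simp only [NNReal.coe_one, mul_one]
    congr 1
    rw [show -(2 * L - Real.log L) / 2 = Real.log L / 2 - L by ring, Real.exp_sub,
      hLdef, Real.exp_log hk0, ← hLdef, ← Real.log_sqrt hL0.le, Real.exp_log (by positivity)]

/-- There is a universal `c > 0` such that for every `k ≥ 2` and `ε ∈ (0,1)` with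
`ε ≤ 1/log k` there is an intersection of `k` halfspaces on `ℝ^k` whose Gaussian noise
sensitivity satisfies `GNS_ε(f) ≥ c √(ε log k)`. -/
theorem stmt_9 : ∃ c > (0:ℝ), ∀ k : ℕ, 2 ≤ k → ∀ ε : ℝ, ε ∈ Set.Ioo (0:ℝ) 1 →
    ε ≤ 1 / Real.log k →
    ∃ f : (Fin k → ℝ) → ℝ, IsIntersectionOfHalfspaces k f ∧
      c * Real.sqrt (ε * Real.log k) ≤ gns k ε f := by
  set p := (gaussianReal 0 1).real (Set.Ioi 3) with hp
  set A := (Real.sqrt (2 * Real.pi))⁻¹ with hA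
  have hp0 : 0 < p := gaussianReal_real_Ioi_pos 3
  have hp1 : p ≤ 1 := measureReal_le_one
  have hA0 : 0 < A := by positivity
  have hA1 : A ≤ 1 / 2 := by
    rw [hA, ← one_div]
    refine one_div_le_one_div_of_le two_pos (Real.le_sqrt_of_sq_le ?_)
    nlinarith [Real.pi_gt_three]
  refine ⟨p * A / 4, by positivity, fun k hk ε ⟨hε0, hε1⟩ hεk => ?_⟩
  obtain ⟨t, htL, htU, hφ⟩ := exists_gaussianPDFReal_eq hk
  refine ⟨orthantIndicator k t, isIntersectionOfHalfspaces_orthantIndicator k t,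
    le_trans ?_ (le_gns_orthantIndicator k ε t)⟩
  have hk0 : (0 : ℝ) < k := by positivity
  have hL : 0.69 ≤ Real.log k :=
    (by linarith [Real.log_two_gt_d9] : (0.69 : ℝ) ≤ Real.log 2).trans
      (Real.log_le_log two_pos (by exact_mod_cast hk))
  have hL0 : 0 < Real.log k := by linarith
  have hℓ : 1 / 2 ≤ Real.sqrt (Real.log k) := Real.le_sqrt_of_sq_le (by linarith)
  have hs : Real.sqrt ε ≤ 1 := Real.sqrt_le_one.2 hε1.le
  have hmul : Real.sqrt (ε * Real.log k) = Real.sqrt ε * Real.sqrt (Real.log k) :=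
    Real.sqrt_mul hε0.le _
  have hu1 : Real.sqrt (ε * Real.log k) ≤ 1 := Real.sqrt_le_one.2 ((le_div_iff₀ hL0).1 hεk)
  set ℓ := Real.sqrt (Real.log k)
  set s := Real.sqrt ε with hsdef
  have hs0 : 0 < s := Real.sqrt_pos.2 hε0
  have hs2 : s * s = ε := Real.mul_self_sqrt hε0.le
  have ht0 : 0 < t := by linarith
  have hεt : ε * t ≤ 2 * s := by
    rw [hmul] at hu1
    calc ε * t ≤ ε * (2 * ℓ) := by gcongr
      _ = 2 * s * (s * ℓ) := by rw [← hs2]; ring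
      _ ≤ 2 * s * 1 := by gcongr
      _ = 2 * s := mul_one _
  have hstable := measureReal_noiseStableSet_le hε0 hε1.le hεt
  have hslab := le_gaussianReal_real_Ioc (t := t) hs0.le (by linarith)
  have htail := gaussianReal_real_Ioi_le ht0
  have hcompl := probReal_add_probReal_compl (μ := gaussianReal 0 1) (measurableSet_Iic (a := t))
  rw [Set.compl_Iic] at hcompl
  have htail' : (gaussianReal 0 1).real (Set.Ioi t) ≤ 1 / (2 * k) := by
    refine htail.trans ?_
    rw [hφ, div_le_iff₀ ht0]
    calc A * (ℓ / k) ≤ 1 / 2 * (t / k) := by gcongr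
      _ = 1 / (2 * k) * t := by field_simp
  have hv1 : p * A * Real.sqrt (ε * Real.log k) ≤ 1 :=
    mul_le_one₀ (mul_le_one₀ hp1 hA0.le (by linarith)) (Real.sqrt_nonneg _) hu1
  calc p * A / 4 * Real.sqrt (ε * Real.log k) = p * A * Real.sqrt (ε * Real.log k) / 4 := by ring
    _ ≤ _ := by
      refine div_four_le_pow_sub_pow (by lia) measureReal_nonneg (by positivity) hv1
        (by linarith) measureReal_le_one (hstable.trans ?_)
      rw [hmul, ← hsdef, ← hp]
      have : p * A * (s * ℓ) / k = s * gaussianPDFReal 0 1 t * p := by rw [hφ]; ring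
      rw [this]
      gcongr
end
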